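/- arXiv:2411.07499 — 2 statements merged into one kernel-verified Lean document; each statement's English description precedes it below -/
import Mathlib

section
/- There exists an absolute constant c > 0 such that the following holds. Let G be a finite simple graph on n vertices containing t copies of C_6, and let A, B ⊆ V(G) be vertex subsets, not necessarily disjoint, with 1 ≤ L ≤ R where L = |A| and R = |B|. Let m = e(A,B), the number of edges of G with one endpoint in A and the other in B. If m ≥ 200·⌈log₂ n⌉^10 · max(R·L^(1/3), L·√R), then t ≥ c·m⁶ / (L³·R³·(log₂ n)^70). -/
open SimpleGraph

/-- The number of subgraphs of `G` isomorphic to the cycle on `n` vertices. -/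
noncomputable def countCopiesOfCycle (n : ℕ) {V : Type*} (G : SimpleGraph V) : ℕ :=
  {H : G.Subgraph | Nonempty (H.coe ≃g cycleGraph n)}.ncard

/-- The number of edges of `G` with one endpoint in `A` and the other in `B`. -/
noncomputable def eCount {V : Type*} (G : SimpleGraph V) (A B : Set V) : ℕ :=
  {e ∈ G.edgeSet | ∃ u ∈ A, ∃ v ∈ B, e = s(u, v)}.ncard

/-- The number of common neighbours of two rows of a `0/1` matrix. -/
def codegree {α β : Type*} [Fintype β] (M : α → β → ℝ) (a₁ a₂ : α) : ℝ :=
  ∑ b, M a₁ b * M a₂ b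

/-- The indicator that three elements are pairwise distinct. -/
def distinctIndicator {α : Type*} [DecidableEq α] (p : α × α × α) : ℝ :=
  if p.1 ≠ p.2.1 ∧ p.2.1 ≠ p.2.2 ∧ p.1 ≠ p.2.2 then 1 else 0

/-- The weight of the closed walk `a₁ b₁ a₂ b₂ a₃ b₃` of length six. -/
def hexWeight {α β : Type*} (M : α → β → ℝ) (p : α × α × α) (q : β × β × β) : ℝ :=
  M p.1 q.1 * M p.2.1 q.1 * (M p.2.1 q.2.1 * M p.2.2 q.2.1) * (M p.2.2 q.2.2 * M p.1 q.2.2)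

lemma codegree_comm {α β : Type*} [Fintype β] (M : α → β → ℝ) (a a' : α) :
    codegree M a a' = codegree M a' a := by
  simp only [codegree, mul_comm]

lemma sum_hexWeight_right {α β : Type*} [Fintype β] (M : α → β → ℝ) (p : α × α × α) :
    ∑ q, hexWeight M p q =
      codegree M p.1 p.2.1 * codegree M p.2.1 p.2.2 * codegree M p.2.2 p.1 := by
  simp only [hexWeight, codegree, Fintype.sum_prod_type, ← Finset.mul_sum, ← Finset.sum_mul]

lemma hexWeight_swap {α β : Type*} (M : α → β → ℝ) (p : α × α × α) (q : β × β × β) :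
    hexWeight M p q = hexWeight (Function.swap M) (q.2.2, q.1, q.2.1) p := by
  simp only [hexWeight, Function.swap]
  ring

lemma sum_hexWeight_left {α β : Type*} [Fintype α] (M : α → β → ℝ) (q : β × β × β) :
    ∑ p, hexWeight M p q = codegree (Function.swap M) q.2.2 q.1 *
      codegree (Function.swap M) q.1 q.2.1 * codegree (Function.swap M) q.2.1 q.2.2 := by
  simp only [← sum_hexWeight_right (Function.swap M) (q.2.2, q.1, q.2.1)]
  exact Finset.sum_congr rfl fun p _ ↦ hexWeight_swap M p q

section
variable {α β : Type*} [Fintype α] [Fintype β]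

lemma sum_codegree_sq_swap (M : α → β → ℝ) :
    ∑ b, ∑ b', codegree (Function.swap M) b b' ^ 2 = ∑ a, ∑ a', codegree M a a' ^ 2 := by
  have h1 : ∀ b b', codegree (Function.swap M) b b' ^ 2 =
      ∑ p : α × α, M p.1 b * M p.1 b' * (M p.2 b * M p.2 b') := fun b b' ↦ by
    simp only [codegree, Function.swap, sq, Finset.sum_mul_sum, Fintype.sum_prod_type]
  have h2 : ∀ a a', codegree M a a' ^ 2 =
      ∑ q : β × β, M a q.1 * M a' q.1 * (M a q.2 * M a' q.2) := fun b b' ↦ by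
    simp only [codegree, sq, Finset.sum_mul_sum, Fintype.sum_prod_type]
  simp only [h1, h2]
  rw [← Fintype.sum_prod_type' (f := fun b b' ↦
    ∑ p : α × α, M p.1 b * M p.1 b' * (M p.2 b * M p.2 b')),
    ← Fintype.sum_prod_type' (f := fun a a' ↦
    ∑ q : β × β, M a q.1 * M a' q.1 * (M a q.2 * M a' q.2)), Finset.sum_comm]
  exact Finset.sum_congr rfl fun _ _ ↦ Finset.sum_congr rfl fun _ _ ↦ by ring

/-- For a symmetric nonnegative `w` whose diagonal is at most `D`, the triangle sum over
non-distinct triples is at most `3 * D * ∑ w ^ 2`. -/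
lemma sum_triangle_degenerate_le [DecidableEq α] (w : α → α → ℝ) (hs : ∀ x y, w x y = w y x)
    (h0 : ∀ x y, 0 ≤ w x y) (D : ℝ) (hD : ∀ x, w x x ≤ D) :
    ∑ p : α × α × α, w p.1 p.2.1 * w p.2.1 p.2.2 * w p.2.2 p.1 * (1 - distinctIndicator p) ≤
      3 * D * ∑ x, ∑ y, w x y ^ 2 := by
  have key : ∀ p : α × α × α,
      w p.1 p.2.1 * w p.2.1 p.2.2 * w p.2.2 p.1 * (1 - distinctIndicator p) ≤
      (if p.1 = p.2.1 then D * w p.1 p.2.2 ^ 2 else 0) +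
      (if p.2.1 = p.2.2 then D * w p.1 p.2.1 ^ 2 else 0) +
      (if p.2.2 = p.1 then D * w p.2.1 p.1 ^ 2 else 0) := by
    rintro ⟨x, y, z⟩
    have hw : ∀ x y, w x x * w x y ^ 2 ≤ D * w x y ^ 2 := fun x y ↦
      mul_le_mul_of_nonneg_right (hD x) (sq_nonneg _)
    have hD0 : ∀ x y, 0 ≤ D * w x y ^ 2 := fun x y ↦
      mul_nonneg ((h0 x x).trans (hD x)) (sq_nonneg _)
    dsimp only [distinctIndicator]
    have n1 : 0 ≤ if x = y then D * w x z ^ 2 else 0 := by split_ifs <;> simp [hD0]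
    have n2 : 0 ≤ if y = z then D * w x y ^ 2 else 0 := by split_ifs <;> simp [hD0]
    have n3 : 0 ≤ if z = x then D * w y x ^ 2 else 0 := by split_ifs <;> simp [hD0]
    by_cases hxy : x = y
    · subst hxy
      have := hw x z
      rw [if_pos rfl] at n1 ⊢
      rw [if_neg (by simp), hs z x]
      linarith
    · by_cases hyz : y = z
      · subst hyz
        have := hw y x
        rw [if_pos rfl] at n2 ⊢
        rw [hs y x] at this n3 ⊢
        rw [if_neg (by simp)]
        linarith
      · by_cases hxz : z = x
        · subst hxz
          have := hw z y
          rw [if_pos rfl] at n3 ⊢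
          rw [if_neg (by simp), hs y z]
          linarith
        · have : x ≠ z := fun h ↦ hxz h.symm
          simp [hxy, hyz, hxz, this]
  refine (Finset.sum_le_sum fun p _ ↦ key p).trans (le_of_eq ?_)
  simp only [Finset.sum_add_distrib, Fintype.sum_prod_type]
  have a1 : ∑ x, ∑ y, ∑ z, (if x = y then D * w x z ^ 2 else 0) = D * ∑ x, ∑ y, w x y ^ 2 := by
    rw [Finset.mul_sum]
    refine Finset.sum_congr rfl fun x _ ↦ ?_
    rw [Finset.sum_comm, Finset.mul_sum]
    simp
  have a2 : ∑ x, ∑ y, ∑ z, (if y = z then D * w x y ^ 2 else 0) = D * ∑ x, ∑ y, w x y ^ 2 := by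
    simp [Finset.mul_sum]
  have a3 : ∑ x, ∑ y, ∑ z, (if z = x then D * w y x ^ 2 else 0) = D * ∑ x, ∑ y, w x y ^ 2 := by
    simp only [Finset.sum_ite_eq', Finset.mem_univ, if_true, Finset.mul_sum]
    exact Finset.sum_comm
  rw [a1, a2, a3]
  ring

lemma three_le_mul_add_inv {x y : ℝ} (hx : 0 < x) (hy : 0 < y) : 3 ≤ x * y + 1 / x + 1 / y := by
  have hxy := mul_pos hx hy
  obtain ⟨s, hs, hs2⟩ : ∃ s, 0 < s ∧ s ^ 2 = x * y := ⟨√(x * y), by positivity, Real.sq_sqrt hxy.le⟩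
  have h1 : 2 * s ≤ x + y := by nlinarith [sq_nonneg (x - y)]
  have h2 : 0 ≤ s * ((s - 1) ^ 2 * (s + 2)) := by positivity
  have h3 : x * y + 1 / x + 1 / y - 3 = (s ^ 4 + (x + y) - 3 * s ^ 2) / (x * y) := by
    rw [show s ^ 4 = (s ^ 2) ^ 2 by ring, hs2]
    field_simp
    ring
  have h4 : 0 ≤ (s ^ 4 + (x + y) - 3 * s ^ 2) / (x * y) := div_nonneg (by nlinarith) hxy.le
  linarith

/-- The number of three-edge walks in a bipartite graph is at least its random value. -/
lemma sum_threeWalk_ge (M : α → β → ℝ) (hM : ∀ a b, M a b = 0 ∨ M a b = 1)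
    (hm : 0 < ∑ a, ∑ b, M a b) :
    (∑ a, ∑ b, M a b) ^ 3 / (Fintype.card α * Fintype.card β) ≤
      ∑ a, ∑ b, M a b * ((∑ b', M a b') * ∑ a', M a' b) := by
  set m := ∑ a, ∑ b, M a b with hmdef
  set L : ℝ := (Fintype.card α : ℝ) with hL
  set R : ℝ := (Fintype.card β : ℝ) with hR
  have h0 : ∀ a b, 0 ≤ M a b := fun a b ↦ by rcases hM a b with h | h <;> simp [h]
  have hm' : m = ∑ b, ∑ a, M a b := Finset.sum_comm
  have hLpos : 0 < L := by
    rw [hL, Nat.cast_pos, Fintype.card_pos_iff]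
    by_contra h
    rw [not_nonempty_iff] at h
    simp [m] at hm
  have hRpos : 0 < R := by
    rw [hR, Nat.cast_pos, Fintype.card_pos_iff]
    by_contra h
    rw [not_nonempty_iff] at h
    simp [m] at hm
  have key : ∀ a b, 3 * M a b ≤ M a b * ((∑ b', M a b') * ∑ a', M a' b) * (L * R / m ^ 2) +
      (m / L) * (M a b / ∑ b', M a b') + (m / R) * (M a b / ∑ a', M a' b) := fun a b ↦ by
    rcases hM a b with h | h
    · simp [h]
    · have p1 : 0 < ∑ b', M a b' := by
        have := Finset.single_le_sum (f := fun b' ↦ M a b') (fun b _ ↦ h0 a b) (Finset.mem_univ b)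
        simp only [h] at this
        linarith
      have p2 : 0 < ∑ a', M a' b := by
        have := Finset.single_le_sum (f := fun a' ↦ M a' b) (fun a _ ↦ h0 a b) (Finset.mem_univ a)
        simp only [h] at this
        linarith
      have := three_le_mul_add_inv (x := (∑ b', M a b') * L / m) (y := (∑ a', M a' b) * R / m)
        (by positivity) (by positivity)
      rw [h]
      refine (by linarith : (3 : ℝ) * 1 ≤ _).trans (this.trans (le_of_eq ?_))
      field_simp
  have row : ∑ a, ∑ b, M a b / ∑ b', M a b' ≤ L := by
    simp only [← Finset.sum_div]
    refine (Finset.sum_le_sum fun a _ ↦ div_self_le_one _).trans ?_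
    simp [hL]
  have col : ∑ a, ∑ b, M a b / ∑ a', M a' b ≤ R := by
    rw [Finset.sum_comm]
    simp only [← Finset.sum_div]
    refine (Finset.sum_le_sum fun a _ ↦ div_self_le_one _).trans ?_
    simp [hR]
  have tot := Finset.sum_le_sum fun a (_ : a ∈ Finset.univ) ↦
    Finset.sum_le_sum fun b (_ : b ∈ Finset.univ) ↦ key a b
  simp only [Finset.sum_add_distrib, ← Finset.mul_sum, ← Finset.sum_mul] at tot
  rw [← hmdef] at tot
  have r1 : m / L * ∑ a, ∑ b, M a b / ∑ b', M a b' ≤ m := by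
    refine (mul_le_mul_of_nonneg_left row (by positivity)).trans (le_of_eq ?_)
    field_simp
  have r2 : m / R * ∑ a, ∑ b, M a b / ∑ a', M a' b ≤ m := by
    refine (mul_le_mul_of_nonneg_left col (by positivity)).trans (le_of_eq ?_)
    field_simp
  have fin : m ≤ (∑ a, ∑ b, M a b * ((∑ b', M a b') * ∑ a', M a' b)) * (L * R / m ^ 2) := by
    linarith
  rw [div_le_iff₀ (by positivity)]
  rw [← mul_div_assoc, le_div_iff₀ (by positivity)] at fin
  linarith

/-- The total weight of closed walks of length six is at least its random value. -/
lemma sum_hexWeight_ge (M : α → β → ℝ) (hM : ∀ a b, M a b = 0 ∨ M a b = 1)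
    (hm : 0 < ∑ a, ∑ b, M a b) :
    ((∑ a, ∑ b, M a b) ^ 2 / (Fintype.card α * Fintype.card β)) ^ 3 ≤
        ∑ p, ∑ q, hexWeight M p q ∧
      (∑ a, ∑ a', codegree M a a' ^ 2) ^ 2 ≤
        (∑ a, ∑ b, M a b) * ∑ p, ∑ q, hexWeight M p q := by
  set m := ∑ a, ∑ b, M a b with hmdef
  set L : ℝ := (Fintype.card α : ℝ) with hL
  set R : ℝ := (Fintype.card β : ℝ) with hR
  have hX : ∑ p, ∑ q, hexWeight M p q =
      ∑ x : α × β, (∑ a', codegree M x.1 a' * M a' x.2) ^ 2 := by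
    simp only [sum_hexWeight_right]
    simp only [Fintype.sum_prod_type, sq, Finset.sum_mul_sum]
    refine Finset.sum_congr rfl fun a _ ↦ ?_
    conv_rhs => rw [Finset.sum_comm]; enter [2, a']; rw [Finset.sum_comm]
    refine Finset.sum_congr rfl fun a' _ ↦ Finset.sum_congr rfl fun a'' _ ↦ ?_
    have : ∀ b, codegree M a a' * M a' b * (codegree M a a'' * M a'' b) =
        codegree M a a' * codegree M a a'' * (M a' b * M a'' b) := fun b ↦ by ring
    simp only [this, ← Finset.mul_sum]
    rw [codegree_comm M a'' a, mul_right_comm]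
    rfl
  have hT : ∑ x : α × β, (∑ a', codegree M x.1 a' * M a' x.2) =
      ∑ a, ∑ b, M a b * ((∑ b', M a b') * ∑ a', M a' b) := by
    have h1 : ∀ a, ∑ b, ∑ a', codegree M a a' * M a' b =
        ∑ a', codegree M a a' * ∑ b, M a' b := fun a ↦ by
      rw [Finset.sum_comm]
      simp only [Finset.mul_sum]
    have h2 : ∀ a', ∑ a, codegree M a a' = ∑ b, M a' b * ∑ a, M a b := fun a' ↦ by
      simp only [codegree, Finset.mul_sum]
      rw [Finset.sum_comm]
      simp only [mul_comm]
    simp only [Fintype.sum_prod_type, h1]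
    rw [Finset.sum_comm]
    simp only [← Finset.sum_mul, h2]
    refine Finset.sum_congr rfl fun a _ ↦ ?_
    rw [Finset.sum_mul]
    exact Finset.sum_congr rfl fun b _ ↦ by ring
  have hY : ∑ a, ∑ a', codegree M a a' ^ 2 =
      ∑ x : α × β, M x.1 x.2 * ∑ a', codegree M x.1 a' * M a' x.2 := by
    simp only [Fintype.sum_prod_type, Finset.mul_sum]
    refine Finset.sum_congr rfl fun a _ ↦ ?_
    rw [Finset.sum_comm]
    refine Finset.sum_congr rfl fun a' _ ↦ ?_
    have : ∀ b, M a b * (codegree M a a' * M a' b) = codegree M a a' * (M a b * M a' b) :=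
      fun b ↦ by ring
    simp only [this, ← Finset.mul_sum]
    exact sq _
  constructor
  · have hCS := sq_sum_le_card_mul_sum_sq (s := (Finset.univ : Finset (α × β)))
      (f := fun x ↦ ∑ a', codegree M x.1 a' * M a' x.2)
    rw [hT, ← hX, Finset.card_univ, Fintype.card_prod] at hCS
    push_cast at hCS
    rw [← hL, ← hR] at hCS
    have h3 := sum_threeWalk_ge M hM hm
    rw [← hmdef, ← hL, ← hR] at h3
    rcases eq_or_ne (L * R) 0 with hLR | hLR
    · rw [hLR, div_zero, zero_pow three_ne_zero, hX]
      exact Finset.sum_nonneg fun _ _ ↦ sq_nonneg _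
    · have hpos : 0 < L * R := lt_of_le_of_ne (by positivity) hLR.symm
      have h4 := (pow_le_pow_left₀ (by positivity) h3 2).trans hCS
      refine le_of_mul_le_mul_left (le_trans (le_of_eq ?_) h4) hpos
      field_simp
  · rw [hY, hX]
    refine (Finset.sum_mul_sq_le_sq_mul_sq _ _ _).trans (le_of_eq ?_)
    congr 1
    rw [hmdef, Fintype.sum_prod_type]
    refine Finset.sum_congr rfl fun a _ ↦ Finset.sum_congr rfl fun b _ ↦ ?_
    rcases hM a b with h | h <;> simp [h]

lemma mul_le_of_sq_le {D K L R m X Y : ℝ} (hL : 0 < L) (hR : 0 < R) (hm : 0 < m)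
    (hK : D * L ≤ K * m) (hmD : m ≤ D * L) (hX : (m ^ 2 / (L * R)) ^ 3 ≤ X)
    (hY : Y ^ 2 ≤ m * X) (hY0 : 0 ≤ Y) (h : 144 * K ^ 3 * R ^ 3 * L ≤ m ^ 3) :
    12 * D * Y ≤ X := by
  have hD : 0 < D := by
    by_contra hD
    nlinarith
  have hDK : D ≤ K * m / L := by rwa [le_div_iff₀ hL]
  by_cases hc : 12 * L * D ^ 2 ≤ Y
  · have h1 : Y * (12 * L * D ^ 2) ≤ (D * L) * X := by
      have hX0 : 0 ≤ X := le_trans (by positivity) hX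
      nlinarith [mul_le_mul_of_nonneg_right hmD hX0, mul_le_mul_of_nonneg_left hc hY0]
    have h2 : 0 < D * L := by positivity
    refine le_of_mul_le_mul_left ?_ h2
    linarith
  · push Not at hc
    have h1 : 12 * D * Y ≤ 144 * L * D ^ 3 := by nlinarith
    have h2 : D ^ 3 ≤ (K * m / L) ^ 3 := pow_le_pow_left₀ hD.le hDK 3
    have h3 : 144 * L * (K * m / L) ^ 3 ≤ (m ^ 2 / (L * R)) ^ 3 := by
      rw [div_pow, div_pow, mul_div_assoc', div_le_div_iff₀ (by positivity) (by positivity)]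
      have := mul_le_mul_of_nonneg_left h (show 0 ≤ m ^ 3 * L ^ 3 by positivity)
      nlinarith
    nlinarith

/-- Supersaturation for hexagons in a `0/1` matrix with bounded row and column sums. -/
lemma sum_hexWeight_distinct_ge [DecidableEq α] [DecidableEq β] (M : α → β → ℝ)
    (hM : ∀ a b, M a b = 0 ∨ M a b = 1) {m L R K D E : ℝ}
    (hmdef : m = ∑ a, ∑ b, M a b) (hL : L = Fintype.card α) (hR : R = Fintype.card β)
    (hm : 0 < m) (hD : ∀ a, ∑ b, M a b ≤ D) (hE : ∀ b, ∑ a, M a b ≤ E)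
    (hDK : D * L ≤ K * m) (hEK : E * R ≤ K * m)
    (h1 : 144 * K ^ 3 * R ^ 3 * L ≤ m ^ 3) (h2 : 144 * K ^ 3 * L ^ 3 * R ≤ m ^ 3) :
    (m ^ 2 / (L * R)) ^ 3 / 2 ≤
      ∑ p, ∑ q, hexWeight M p q * (distinctIndicator p * distinctIndicator q) := by
  have h0 : ∀ a b, 0 ≤ M a b := fun a b ↦ by rcases hM a b with h | h <;> simp [h]
  have hsq : ∀ a b, M a b * M a b = M a b := fun a b ↦ by rcases hM a b with h | h <;> simp [h]
  have hc0 : ∀ a a', 0 ≤ codegree M a a' := fun a a' ↦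
    Finset.sum_nonneg fun b _ ↦ mul_nonneg (h0 _ _) (h0 _ _)
  have hc0' : ∀ b b', 0 ≤ codegree (Function.swap M) b b' := fun a a' ↦
    Finset.sum_nonneg fun b _ ↦ mul_nonneg (h0 _ _) (h0 _ _)
  have hmL : m ≤ D * L := by
    rw [hmdef, hL]
    refine (Finset.sum_le_sum fun a _ ↦ hD a).trans (le_of_eq ?_)
    simp [mul_comm]
  have hmR : m ≤ E * R := by
    rw [hmdef, hR, Finset.sum_comm]
    refine (Finset.sum_le_sum fun a _ ↦ hE a).trans (le_of_eq ?_)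
    simp [mul_comm]
  have hLpos : 0 < L := by
    have : 0 ≤ L := by rw [hL]; positivity
    rcases this.eq_or_lt with h | h
    · rw [← h] at hmL; linarith
    · exact h
  have hRpos : 0 < R := by
    have : 0 ≤ R := by rw [hR]; positivity
    rcases this.eq_or_lt with h | h
    · rw [← h] at hmR; linarith
    · exact h
  obtain ⟨hX, hY⟩ := sum_hexWeight_ge M hM (hmdef ▸ hm)
  rw [← hmdef] at hX hY
  rw [← hL, ← hR] at hX
  set X := ∑ p, ∑ q, hexWeight M p q with hXdef
  set Y := ∑ a, ∑ a', codegree M a a' ^ 2 with hYdef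
  have hY0 : 0 ≤ Y := Finset.sum_nonneg fun _ _ ↦ Finset.sum_nonneg fun _ _ ↦ sq_nonneg _
  have bD := mul_le_of_sq_le hLpos hRpos hm hDK hmL hX hY hY0 h1
  have bE := mul_le_of_sq_le hRpos hLpos hm hEK hmR (by rwa [mul_comm R L]) hY hY0 h2
  have dA : ∑ p, ∑ q, hexWeight M p q * (1 - distinctIndicator p) ≤ 3 * D * Y := by
    simp only [← Finset.sum_mul, sum_hexWeight_right]
    exact sum_triangle_degenerate_le (codegree M) (codegree_comm M) hc0 D fun a ↦ by
      simpa only [codegree, hsq] using hD a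
  have dB : ∑ p, ∑ q, hexWeight M p q * (1 - distinctIndicator q) ≤ 3 * E * Y := by
    rw [Finset.sum_comm, hYdef, ← sum_codegree_sq_swap]
    simp only [← Finset.sum_mul, sum_hexWeight_left]
    refine le_trans (le_of_eq ?_) (sum_triangle_degenerate_le (codegree (Function.swap M))
      (codegree_comm _) hc0' E fun a ↦ by simpa only [codegree, Function.swap, hsq] using hE a)
    exact Finset.sum_congr rfl fun q _ ↦ by ring
  have hpt : ∀ p q, hexWeight M p q - hexWeight M p q * (1 - distinctIndicator p) -
      hexWeight M p q * (1 - distinctIndicator q) ≤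
      hexWeight M p q * (distinctIndicator p * distinctIndicator q) := fun p q ↦ by
    have hw : 0 ≤ hexWeight M p q := by
      unfold hexWeight
      exact mul_nonneg (mul_nonneg (mul_nonneg (h0 _ _) (h0 _ _)) (mul_nonneg (h0 _ _) (h0 _ _)))
        (mul_nonneg (h0 _ _) (h0 _ _))
    have i1 : distinctIndicator p ≤ 1 := by unfold distinctIndicator; split_ifs <;> norm_num
    have i2 : distinctIndicator q ≤ 1 := by unfold distinctIndicator; split_ifs <;> norm_num
    nlinarith [mul_nonneg hw (mul_nonneg (sub_nonneg.2 i1) (sub_nonneg.2 i2))]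
  have tot := Finset.sum_le_sum fun p (_ : p ∈ Finset.univ) ↦
    Finset.sum_le_sum fun q (_ : q ∈ Finset.univ) ↦ hpt p q
  simp only [Finset.sum_sub_distrib] at tot
  linarith
end

section
variable {V : Type*} [Fintype V]

/-- Each subgraph isomorphic to a `k`-cycle comes from at most `k ^ k` labelled copies. -/
lemma card_copy_cycleGraph_le (G : SimpleGraph V) (k : ℕ) :
    Nat.card (Copy (cycleGraph k) G) ≤ k ^ k * countCopiesOfCycle k G := by
  classical
  have : Finite (Copy (cycleGraph k) G) := Finite.of_injective _ DFunLike.coe_injective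
  have : Fintype (Copy (cycleGraph k) G) := Fintype.ofFinite _
  rw [Nat.card_eq_fintype_card, ← Finset.card_univ]
  refine (Finset.card_le_mul_card_image (f := Copy.toSubgraph) _ (k ^ k) fun H hH ↦ ?_).trans
    (Nat.mul_le_mul_left _ ?_)
  · obtain ⟨g, -, rfl⟩ := Finset.mem_image.1 hH
    let T : Finset V := Finset.univ.image g
    have hT : T.card ≤ k := Finset.card_image_le.trans (by simp)
    have hcard : (Fintype.piFinset fun _ : Fin k ↦ T).card ≤ k ^ k := by
      rw [Fintype.card_piFinset_const]
      simpa using Nat.pow_le_pow_left hT k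
    refine le_trans (Finset.card_le_card_of_injOn (fun f ↦ (f : Fin k → V)) ?_ ?_) hcard
    · intro f hf
      simp only [Finset.coe_filter, Finset.mem_univ, true_and, Set.mem_ofPred_eq] at hf
      simp only [Finset.mem_coe, Fintype.mem_piFinset]
      intro i
      have hi : f i ∈ f.toSubgraph.verts := by simp
      rw [hf] at hi
      simpa [T] using hi
    · exact DFunLike.coe_injective.injOn
  · rw [countCopiesOfCycle, ← Set.ncard_coe_finset]
    refine Set.ncard_le_ncard ?_ (Set.toFinite _)
    intro H hH
    simp only [Finset.coe_image, Finset.coe_univ, Set.image_univ, Set.mem_range] at hH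
    obtain ⟨f, rfl⟩ := hH
    exact ⟨f.isoToSubgraph.symm⟩

/-- The biadjacency matrix between two vertex sets. -/
def biadjacency (G : SimpleGraph V) [DecidableRel G.Adj] (A B : Finset V) (a : A) (b : B) : ℝ :=
  if G.Adj a b then 1 else 0

lemma sum_hexWeight_le_card_copy [DecidableEq V] (G : SimpleGraph V) [DecidableRel G.Adj]
    {A B : Finset V} (hAB : Disjoint A B) :
    ∑ p, ∑ q, hexWeight (biadjacency G A B) p q * (distinctIndicator p * distinctIndicator q) ≤
      Nat.card (Copy (cycleGraph 6) G) := by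
  classical
  let good : (A × A × A) × (B × B × B) → Prop := fun x ↦
    ((x.1.1 ≠ x.1.2.1 ∧ x.1.2.1 ≠ x.1.2.2 ∧ x.1.1 ≠ x.1.2.2) ∧
      (x.2.1 ≠ x.2.2.1 ∧ x.2.2.1 ≠ x.2.2.2 ∧ x.2.1 ≠ x.2.2.2)) ∧
    ((G.Adj x.1.1 x.2.1 ∧ G.Adj x.1.2.1 x.2.1) ∧ (G.Adj x.1.2.1 x.2.2.1 ∧
      G.Adj x.1.2.2 x.2.2.1) ∧ (G.Adj x.1.2.2 x.2.2.2 ∧ G.Adj x.1.1 x.2.2.2))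
  have hne : ∀ (a : A) (b : B), (a : V) ≠ b := fun a b h ↦
    Finset.disjoint_left.1 hAB a.2 (h ▸ b.2)
  have hfin : Finite (Copy (cycleGraph 6) G) := Finite.of_injective _ DFunLike.coe_injective
  let φ : {x // good x} → Copy (cycleGraph 6) G := fun x ↦
    ⟨⟨![x.1.1.1, x.1.2.1, x.1.1.2.1, x.1.2.2.1, x.1.1.2.2, x.1.2.2.2], by
      obtain ⟨x, -, ⟨h1, h2⟩, ⟨h3, h4⟩, h5, h6⟩ := x
      intro i j hij
      rw [cycleGraph_adj] at hij
      fin_cases i <;> fin_cases j <;> first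
        | exact absurd hij (by decide)
        | exact h1 | exact h1.symm | exact h2 | exact h2.symm | exact h3 | exact h3.symm
        | exact h4 | exact h4.symm | exact h5 | exact h5.symm | exact h6 | exact h6.symm⟩, by
      obtain ⟨x, ⟨⟨h1, h2, h3⟩, h4, h5, h6⟩, -⟩ := x
      intro i j hij
      have hne' : ∀ (b : B) (a : A), (b : V) ≠ a := fun b a h ↦ hne a b h.symm
      fin_cases i <;> fin_cases j <;> first
        | rfl
        | (simp [hne, hne', h1, h2, h3, h4, h5, h6, h1.symm, h2.symm, h3.symm, h4.symm, h5.symm,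
            h6.symm] at hij)⟩
  have hφ : Function.Injective φ := by
    intro x y h
    have h' := fun i ↦ congrArg (fun f : Copy (cycleGraph 6) G ↦ f i) h
    obtain ⟨⟨⟨a, b, c⟩, d, e, f⟩, hx⟩ := x
    obtain ⟨⟨⟨a', b', c'⟩, d', e', f'⟩, hy⟩ := y
    have e0 : (a : V) = a' := h' 0
    have e1 : (d : V) = d' := h' 1
    have e2 : (b : V) = b' := h' 2
    have e3 : (e : V) = e' := h' 3
    have e4 : (c : V) = c' := h' 4
    have e5 : (f : V) = f' := h' 5
    simp only [Subtype.mk.injEq, Prod.mk.injEq]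
    exact ⟨⟨Subtype.ext e0, Subtype.ext e2, Subtype.ext e4⟩, Subtype.ext e1, Subtype.ext e3,
      Subtype.ext e5⟩
  have hcard := Nat.card_le_card_of_injective φ hφ
  rw [Nat.card_eq_fintype_card, Fintype.card_subtype] at hcard
  refine le_trans (le_of_eq ?_) (Nat.cast_le.2 hcard)
  rw [Finset.card_filter, Nat.cast_sum]
  refine .trans ?_ (Fintype.sum_prod_type _).symm
  refine Finset.sum_congr rfl fun p _ ↦ Finset.sum_congr rfl fun q _ ↦ ?_
  simp only [hexWeight, biadjacency, distinctIndicator, ite_zero_mul_ite_zero, mul_one, Nat.cast_ite,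
    Nat.cast_one, Nat.cast_zero, good]
  exact if_congr (by tauto) rfl rfl

/-- Passing to disjoint subsets keeps a quarter of the edges. -/
lemma exists_disjoint_eCount_le [DecidableEq V] (G : SimpleGraph V) [DecidableRel G.Adj]
    (A B : Finset V) : ∃ A' ⊆ A, ∃ B' ⊆ B, Disjoint A' B' ∧
      eCount G A B ≤ 4 * (G.interedges A' B').card := by
  have h1 : eCount G A B ≤ (G.interedges A B).card := by
    have : {e ∈ G.edgeSet | ∃ u ∈ (A : Set V), ∃ v ∈ (B : Set V), e = s(u, v)} ⊆
        ((G.interedges A B).image fun p ↦ s(p.1, p.2) : Finset (Sym2 V)) := by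
      rintro e ⟨he, u, hu, v, hv, rfl⟩
      simp only [Finset.coe_image, Set.mem_image, Finset.mem_coe]
      exact ⟨(u, v), (mem_interedges_iff G).2 ⟨hu, hv, he⟩, rfl⟩
    refine (Set.ncard_le_ncard this (Set.toFinite _)).trans ?_
    rw [Set.ncard_coe_finset]
    exact Finset.card_image_le
  have hcut : ∀ u v : V, u ≠ v →
      4 * (Finset.univ.filter fun f : V → Bool ↦ f u = false ∧ f v = true).card =
        Fintype.card (V → Bool) := by
    intro u v huv
    let c : V → Finset Bool := fun x ↦ if x = u then {false} else if x = v then {true} else .univ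
    have hfil : (Finset.univ.filter fun f : V → Bool ↦ f u = false ∧ f v = true) =
        Fintype.piFinset c := by
      ext f
      simp only [Finset.mem_filter, Finset.mem_univ, true_and, Fintype.mem_piFinset, c]
      constructor
      · rintro ⟨h1, h2⟩ x
        split_ifs with h h'
        · simp [h, h1]
        · simp [h', h2]
        · simp
      · intro h
        have hu := h u
        have hv := h v
        simp only [if_true, if_neg huv.symm, Finset.mem_singleton] at hu hv
        exact ⟨hu, hv⟩
    have h4 : (4 : ℕ) = ∏ x : V, (if x = u then 2 else 1) * (if x = v then 2 else 1) := by
      rw [Finset.prod_mul_distrib]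
      simp
    rw [hfil, Fintype.card_piFinset, h4, ← Finset.prod_mul_distrib, Fintype.card_fun,
      Fintype.card_bool, ← Finset.card_univ, ← Finset.prod_const]
    refine Finset.prod_congr rfl fun x _ ↦ ?_
    by_cases h : x = u
    · subst h
      simp [c, huv]
    · by_cases h' : x = v
      · subst h'
        simp [c, h]
      · simp [c, h, h']
  by_contra! hcon
  have h2 : ∀ f : V → Bool, 4 * (∑ p ∈ G.interedges A B,
      if f p.1 = false ∧ f p.2 = true then 1 else 0) < eCount G A B := by
    intro f
    refine lt_of_le_of_lt (Nat.mul_le_mul_left 4 ?_) (hcon (A.filter fun u ↦ f u = false)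
      (Finset.filter_subset _ _) (B.filter fun u ↦ f u = true) (Finset.filter_subset _ _) ?_)
    · rw [← Finset.card_filter]
      refine Finset.card_le_card fun p hp ↦ ?_
      obtain ⟨hp, h⟩ := Finset.mem_filter.1 hp
      obtain ⟨ha, hb, hadj⟩ := (mem_interedges_iff G).1 hp
      exact (mem_interedges_iff G).2
        ⟨Finset.mem_filter.2 ⟨ha, h.1⟩, Finset.mem_filter.2 ⟨hb, h.2⟩, hadj⟩
    · rw [Finset.disjoint_left]
      intro x hx hx'
      simp_all
  have h3 := Finset.sum_lt_sum_of_nonempty (s := (Finset.univ : Finset (V → Bool)))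
    Finset.univ_nonempty fun f _ ↦ h2 f
  rw [← Finset.mul_sum, Finset.sum_comm, Finset.mul_sum] at h3
  simp only [← Finset.card_filter] at h3
  rw [Finset.sum_congr rfl fun p hp ↦ hcut p.1 p.2
    ((mem_interedges_iff G).1 hp).2.2.ne] at h3
  simp only [Finset.sum_const, smul_eq_mul, Finset.card_univ] at h3
  rw [mul_comm] at h3
  exact absurd (lt_of_mul_lt_mul_left' h3) (not_lt.2 h1)

/-- Dyadic regularization: some pair of degree classes carries a `1 / ℓ ^ 2` fraction of the
edges, and in it the maximum degrees are comparable to the average ones. -/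
lemma exists_regular_interedges [DecidableEq V] (G : SimpleGraph V) [DecidableRel G.Adj]
    (A B : Finset V) (hV : 2 ≤ Fintype.card V) : ∃ A' ⊆ A, ∃ B' ⊆ B, ∃ D E : ℕ,
      (G.interedges A B).card ≤
        Nat.clog 2 (Fintype.card V) ^ 2 * (G.interedges A' B').card ∧
      D * A'.card ≤ 2 * (G.interedges A B).card ∧ E * B'.card ≤ 2 * (G.interedges A B).card ∧
      (∀ a ∈ A', (B'.filter fun b ↦ G.Adj a b).card ≤ D) ∧
      (∀ b ∈ B', (A'.filter fun a ↦ G.Adj a b).card ≤ E) := by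
  set ℓ := Nat.clog 2 (Fintype.card V)
  have hℓ0 : 0 < ℓ := Nat.clog_pos one_lt_two hV
  let d : V → ℕ := fun a ↦ (B.filter fun b ↦ G.Adj a b).card
  let e : V → ℕ := fun b ↦ (A.filter fun a ↦ G.Adj a b).card
  have hlog : ∀ k : ℕ, k < Fintype.card V → Nat.log 2 k < ℓ := fun k hk ↦ by
    rcases eq_or_ne k 0 with rfl | h
    · simpa using hℓ0
    · exact Nat.log_lt_of_lt_pow h (hk.trans_le (Nat.le_pow_clog one_lt_two _))
  have hd : ∀ a, d a < Fintype.card V := fun a ↦ by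
    refine Finset.card_lt_univ_of_notMem (x := a) ?_
    simp
  have he : ∀ b, e b < Fintype.card V := fun b ↦ by
    refine Finset.card_lt_univ_of_notMem (x := b) ?_
    simp
  obtain ⟨⟨i, j⟩, -, hij⟩ := Finset.exists_le_card_fiber_of_nsmul_le_card_of_maps_to
    (s := G.interedges A B) (t := Finset.range ℓ ×ˢ Finset.range ℓ)
    (f := fun p ↦ (Nat.log 2 (d p.1), Nat.log 2 (e p.2)))
    (b := ((G.interedges A B).card : ℚ) / ℓ ^ 2)
    (fun p _ ↦ by simp [hlog _ (hd _), hlog _ (he _)])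
    ⟨(0, 0), by simp [hℓ0]⟩
    (by
      have : (ℓ : ℚ) ≠ 0 := by positivity
      simp only [Finset.card_product, Finset.card_range, nsmul_eq_mul, Nat.cast_mul]
      apply le_of_eq
      field_simp)
  let A' := A.filter fun a ↦ d a ≠ 0 ∧ Nat.log 2 (d a) = i
  let B' := B.filter fun b ↦ e b ≠ 0 ∧ Nat.log 2 (e b) = j
  have hA' : A' ⊆ A := Finset.filter_subset _ _
  have hB' : B' ⊆ B := Finset.filter_subset _ _
  have sumd : ∑ a ∈ A, d a = (G.interedges A B).card := by
    rw [interedges, Rel.interedges, Finset.card_filter, Finset.sum_product]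
    exact Finset.sum_congr rfl fun a _ ↦ Finset.card_filter _ _
  have sume : ∑ b ∈ B, e b = (G.interedges A B).card := by
    rw [interedges, Rel.interedges, Finset.card_filter, Finset.sum_product_right]
    exact Finset.sum_congr rfl fun a _ ↦ Finset.card_filter _ _
  refine ⟨A', hA', B', hB', 2 ^ (i + 1), 2 ^ (j + 1), ?_, ?_, ?_, ?_, ?_⟩
  · rw [div_le_iff₀ (by positivity)] at hij
    have hsub : (G.interedges A B).filter
        (fun p ↦ (Nat.log 2 (d p.1), Nat.log 2 (e p.2)) = (i, j)) ⊆ G.interedges A' B' := by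
      intro p hp
      obtain ⟨hp, h⟩ := Finset.mem_filter.1 hp
      obtain ⟨ha, hb, hadj⟩ := (mem_interedges_iff G).1 hp
      rw [Prod.mk.injEq] at h
      refine (mem_interedges_iff G).2 ⟨Finset.mem_filter.2 ⟨ha, ?_, h.1⟩,
        Finset.mem_filter.2 ⟨hb, ?_, h.2⟩, hadj⟩
      · exact (Finset.card_pos.2 ⟨p.2, Finset.mem_filter.2 ⟨hb, hadj⟩⟩).ne'
      · exact (Finset.card_pos.2 ⟨p.1, Finset.mem_filter.2 ⟨ha, hadj⟩⟩).ne'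
    have hij' : (G.interedges A B).card ≤ ((G.interedges A B).filter
        (fun p ↦ (Nat.log 2 (d p.1), Nat.log 2 (e p.2)) = (i, j))).card * ℓ ^ 2 := by
      exact_mod_cast hij
    refine hij'.trans ?_
    rw [mul_comm]
    exact Nat.mul_le_mul_left _ (Finset.card_le_card hsub)
  · rw [← sumd, pow_succ, mul_comm _ 2, mul_assoc]
    refine Nat.mul_le_mul_left 2 ?_
    rw [mul_comm, ← smul_eq_mul]
    refine (Finset.card_nsmul_le_sum A' d _ fun a ha ↦ ?_).trans
      (Finset.sum_le_sum_of_subset hA')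
    obtain ⟨-, h0, rfl⟩ := Finset.mem_filter.1 ha
    exact Nat.pow_log_le_self 2 h0
  · rw [← sume, pow_succ, mul_comm _ 2, mul_assoc]
    refine Nat.mul_le_mul_left 2 ?_
    rw [mul_comm, ← smul_eq_mul]
    refine (Finset.card_nsmul_le_sum B' e _ fun a ha ↦ ?_).trans
      (Finset.sum_le_sum_of_subset hB')
    obtain ⟨-, h0, rfl⟩ := Finset.mem_filter.1 ha
    exact Nat.pow_log_le_self 2 h0
  · intro a ha
    obtain ⟨-, -, rfl⟩ := Finset.mem_filter.1 ha
    exact (Finset.card_le_card (Finset.filter_subset_filter _ hB')).trans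
      (Nat.lt_pow_succ_log_self one_lt_two _).le
  · intro b hb
    obtain ⟨-, -, rfl⟩ := Finset.mem_filter.1 hb
    exact (Finset.card_le_card (Finset.filter_subset_filter _ hA')).trans
      (Nat.lt_pow_succ_log_self one_lt_two _).le
end

lemma sum_biadjacency_right {V : Type*} (G : SimpleGraph V) [DecidableRel G.Adj]
    (A B : Finset V) (a : A) :
    ∑ b, biadjacency G A B a b = (B.filter fun b ↦ G.Adj a b).card := by
  simp only [biadjacency]
  rw [Finset.sum_coe_sort B fun b ↦ if G.Adj a b then (1 : ℝ) else 0, Finset.sum_boole]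

lemma sum_biadjacency_left {V : Type*} (G : SimpleGraph V) [DecidableRel G.Adj]
    (A B : Finset V) (b : B) :
    ∑ a, biadjacency G A B a b = (A.filter fun a ↦ G.Adj a b).card := by
  simp only [biadjacency]
  rw [Finset.sum_coe_sort A fun a ↦ if G.Adj a b then (1 : ℝ) else 0, Finset.sum_boole]

lemma sum_biadjacency {V : Type*} (G : SimpleGraph V) [DecidableRel G.Adj] (A B : Finset V) :
    ∑ a, ∑ b, biadjacency G A B a b = (G.interedges A B).card := by
  simp only [sum_biadjacency_right]
  rw [Finset.sum_coe_sort A fun a ↦ ((B.filter fun b ↦ G.Adj a b).card : ℝ), interedges,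
    Rel.interedges, Finset.card_filter, Finset.sum_product, Nat.cast_sum]
  exact Finset.sum_congr rfl fun a _ ↦ by rw [Finset.card_filter]

lemma le_cube_of_density {L R L' R' l m m' : ℝ} (hL : 0 ≤ L) (hR : 1 ≤ R) (hl : 1 ≤ l)
    (hL' : 0 ≤ L') (hR' : 0 ≤ R') (hLL : L' ≤ L) (hRR : R' ≤ R) (hmm : m ≤ 4 * l ^ 2 * m')
    (h : 200 * l ^ 10 * max (R * L ^ ((1 : ℝ) / 3)) (L * √R) ≤ m) :
    144 * (2 * l ^ 2) ^ 3 * R' ^ 3 * L' ≤ m' ^ 3 ∧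
      144 * (2 * l ^ 2) ^ 3 * L' ^ 3 * R' ≤ m' ^ 3 := by
  have hl0 : 0 < l := by linarith
  have hlow : 50 * l ^ 8 * max (R * L ^ ((1 : ℝ) / 3)) (L * √R) ≤ m' := by
    refine le_of_mul_le_mul_left ?_ (show 0 < 4 * l ^ 2 by positivity)
    calc _ = 200 * l ^ 10 * max (R * L ^ ((1 : ℝ) / 3)) (L * √R) := by ring
      _ ≤ _ := h.trans hmm
  have hcube : ∀ x y : ℝ, 0 ≤ x → 50 * l ^ 8 * x ≤ m' → y ≤ x ^ 3 → 0 ≤ y →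
      144 * (2 * l ^ 2) ^ 3 * y ≤ m' ^ 3 := by
    intro x y hx hxm hy hy0
    calc 144 * (2 * l ^ 2) ^ 3 * y = 1152 * l ^ 6 * y := by ring
      _ ≤ 125000 * l ^ 24 * x ^ 3 := by
        gcongr
        · norm_num
        · norm_num
      _ = (50 * l ^ 8 * x) ^ 3 := by ring
      _ ≤ m' ^ 3 := pow_le_pow_left₀ (by positivity) hxm 3
  constructor
  · rw [mul_assoc _ (R' ^ 3)]
    refine hcube (R * L ^ ((1 : ℝ) / 3)) _ (by positivity)
      (le_trans (by gcongr; exact le_max_left _ _) hlow) ?_ (by positivity)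
    rw [mul_pow, ← Real.rpow_natCast (L ^ _), ← Real.rpow_mul hL]
    norm_num
    gcongr
  · rw [mul_assoc _ (L' ^ 3)]
    refine hcube (L * √R) _ (by positivity)
      (le_trans (by gcongr; exact le_max_right _ _) hlow) ?_ (by positivity)
    have h1 : 1 ≤ √R := Real.one_le_sqrt.2 hR
    have h2 : √R ^ 2 = R := Real.sq_sqrt (by linarith)
    rw [mul_pow]
    have : R' ≤ √R ^ 3 := by nlinarith
    gcongr

/-- Corollary of partial hexagon supersaturation for not necessarily disjoint subsets. -/
theorem hexagon_supersaturation_subsets :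
    ∃ c : ℝ, 0 < c ∧
      ∀ (V : Type) [Fintype V] [DecidableEq V] (G : SimpleGraph V) [DecidableRel G.Adj]
        (A B : Finset V), ∀ (L R m t n : ℕ),
          L = A.card → R = B.card → m = eCount G ↑A ↑B → t = countCopiesOfCycle 6 G →
          n = Fintype.card V →
          1 ≤ L → L ≤ R →
          (m : ℝ) ≥ 200 * (Nat.clog 2 n : ℝ) ^ 10 *
            max ((R : ℝ) * (L : ℝ) ^ ((1 : ℝ) / 3)) ((L : ℝ) * Real.sqrt (R : ℝ)) →
          (t : ℝ) ≥ c * (m : ℝ) ^ 6 /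
            ((L : ℝ) ^ 3 * (R : ℝ) ^ 3 * (Real.logb 2 (n : ℝ)) ^ 70) := by
  refine ⟨1 / 10 ^ 13, by positivity, ?_⟩
  intro V _ _ G _ A B L R m t n hL hR hm ht hn hL1 hLR hmL
  rcases Nat.eq_zero_or_pos m with hm0 | hm0
  · simp [hm0]
  rcases Nat.lt_or_ge n 2 with hn2 | hn2
  · interval_cases n <;> simp
  obtain ⟨A₀, hA₀, B₀, hB₀, hdisj, hcut⟩ := exists_disjoint_eCount_le G A B
  obtain ⟨A₁, hA₁, B₁, hB₁, D, E, hP, hDA, hEB, hD, hE⟩ :=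
    exists_regular_interedges G A₀ B₀ (hn ▸ hn2)
  rw [← hn] at hP
  rw [← hm] at hcut
  set l := Nat.clog 2 n
  set m₀ := (G.interedges A₀ B₀).card
  set m₁ := (G.interedges A₁ B₁).card
  have hl1 : (1 : ℝ) ≤ l := by exact_mod_cast Nat.clog_pos one_lt_two hn2
  have hPR : (m₀ : ℝ) ≤ l ^ 2 * m₁ := by exact_mod_cast hP
  have hmm : (m : ℝ) ≤ 4 * l ^ 2 * m₁ := by
    have : (m : ℝ) ≤ 4 * m₀ := by exact_mod_cast hcut
    linarith
  have hLA : (A₁.card : ℝ) ≤ L := by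
    rw [hL]
    exact_mod_cast Finset.card_le_card (hA₁.trans hA₀)
  have hRB : (B₁.card : ℝ) ≤ R := by
    rw [hR]
    exact_mod_cast Finset.card_le_card (hB₁.trans hB₀)
  have hm0R : (0 : ℝ) < m := by exact_mod_cast hm0
  have hm₁pos : (0 : ℝ) < m₁ := by
    by_contra hcon
    nlinarith [sq_nonneg (l : ℝ)]
  obtain ⟨c1, c2⟩ := le_cube_of_density (Nat.cast_nonneg L)
    (by exact_mod_cast hL1.trans hLR) hl1 (Nat.cast_nonneg A₁.card) (Nat.cast_nonneg B₁.card)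
    hLA hRB hmm hmL
  have hcore := sum_hexWeight_distinct_ge (biadjacency G A₁ B₁)
    (fun a b ↦ by unfold biadjacency; split_ifs <;> simp)
    (m := m₁) (L := A₁.card) (R := B₁.card) (K := 2 * (l : ℝ) ^ 2) (D := D) (E := E)
    (sum_biadjacency G A₁ B₁).symm (by simp) (by simp) hm₁pos
    (fun a ↦ by rw [sum_biadjacency_right]; exact_mod_cast hD a a.2)
    (fun b ↦ by rw [sum_biadjacency_left]; exact_mod_cast hE b b.2)
    (by
      have : (D : ℝ) * A₁.card ≤ 2 * m₀ := by exact_mod_cast hDA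
      linarith)
    (by
      have : (E : ℝ) * B₁.card ≤ 2 * m₀ := by exact_mod_cast hEB
      linarith) c1 c2
  have hcopies := sum_hexWeight_le_card_copy G
    (Finset.disjoint_of_subset_left hA₁ (Finset.disjoint_of_subset_right hB₁ hdisj))
  have hlab : (Nat.card (Copy (cycleGraph 6) G) : ℝ) ≤ 46656 * t := by
    rw [ht]
    exact_mod_cast card_copy_cycleGraph_le G 6
  have htot : ((m₁ : ℝ) ^ 2 / (A₁.card * B₁.card)) ^ 3 ≤ 93312 * t := by linarith
  have hAB : (0 : ℝ) < A₁.card * B₁.card := by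
    have : m₁ ≤ A₁.card * B₁.card := Rel.card_interedges_le_mul _ _ _
    have : (m₁ : ℝ) ≤ A₁.card * B₁.card := by exact_mod_cast this
    linarith
  have hlog : (1 : ℝ) ≤ Real.logb 2 n := by
    rw [Real.le_logb_iff_rpow_le one_lt_two (by positivity)]
    exact_mod_cast hn2
  have hllog : (l : ℝ) ≤ 2 * Real.logb 2 n := by
    have h1 := Nat.ceil_lt_add_one (zero_le_one.trans hlog)
    have h2 := Real.natCeil_logb_natCast 2 n
    rw [Nat.cast_ofNat] at h2
    rw [h2] at h1
    linarith
  set lg := Real.logb 2 (n : ℝ)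
  have hLpos : (0 : ℝ) < L := by exact_mod_cast hL1
  have hRpos : (0 : ℝ) < R := by exact_mod_cast hL1.trans hLR
  rw [div_pow, div_le_iff₀ (by positivity)] at htot
  rw [ge_iff_le, div_le_iff₀ (by positivity)]
  have s1 : (m : ℝ) ^ 6 ≤ 4096 * l ^ 12 * m₁ ^ 6 :=
    (pow_le_pow_left₀ hm0R.le hmm 6).trans (le_of_eq (by ring))
  have s2 : (l : ℝ) ^ 12 ≤ 4096 * lg ^ 70 :=
    (pow_le_pow_left₀ (by linarith) hllog 12).trans <| by
      rw [mul_pow]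
      norm_num1
      gcongr
      norm_num
  have s3 : (m₁ : ℝ) ^ 6 ≤ 93312 * t * (L ^ 3 * R ^ 3) := by
    rw [← mul_pow]
    refine (le_of_eq (by ring)).trans (htot.trans ?_)
    gcongr
  calc 1 / 10 ^ 13 * (m : ℝ) ^ 6 ≤ 1 / 10 ^ 13 * (4096 * (4096 * lg ^ 70) *
        (93312 * t * (L ^ 3 * R ^ 3))) := by
        gcongr
        exact s1.trans (by gcongr)
    _ = 4096 * 4096 * 93312 / 10 ^ 13 * (t * (L ^ 3 * R ^ 3 * lg ^ 70)) := by ring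
    _ ≤ 1 * (t * (L ^ 3 * R ^ 3 * lg ^ 70)) := by
        gcongr
        norm_num
    _ = _ := one_mul _
end

section
/- Let G be a finite simple graph, let v be a vertex of G, let S ⊆ N(v), and let X and Z be vertex sets such that the sets S, X, Z, and {v} are pairwise disjoint. Let δ ≥ 4 be a real number and suppose every w ∈ X has at least δ/2 neighbors in S. Let P be the number of triples (w₁, z, w₂) with w₁, w₂ ∈ X distinct and z ∈ Z adjacent to both w₁ and w₂. Then the number of copies of C_6 in G containing the vertex v is at least δ²·P/16. -/
open SimpleGraph

/-- The number of copies of the hexagon `C₆` in `G` containing the vertex `v`. -/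
noncomputable def hexCountAt {V : Type*} (G : SimpleGraph V) (v : V) : ℕ :=
  {H : G.Subgraph | v ∈ H.verts ∧ Nonempty (H.coe ≃g cycleGraph 6)}.ncard

/-- Two hexagon copies with the same base point and the same image are equal up to reflection. -/
theorem copy_eq_or_eq_neg_of_toSubgraph_eq {V : Type*} {G : SimpleGraph V}
    {φ ψ : Copy (cycleGraph 6) G} (h0 : φ 0 = ψ 0) (h : φ.toSubgraph = ψ.toSubgraph) :
    (⇑ψ = ⇑φ) ∨ (⇑ψ = fun i => φ (-i)) := by
  have hadj : ∀ i j, (cycleGraph 6).Adj i j →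
      ∃ a b, (cycleGraph 6).Adj a b ∧ φ a = ψ i ∧ φ b = ψ j := by
    intro i j hij
    have h1 : ψ.toSubgraph.Adj (ψ i) (ψ j) := by
      simp only [Copy.toSubgraph, Subgraph.map_adj, Relation.Map]
      exact ⟨i, j, hij, rfl, rfl⟩
    rw [← h] at h1
    simp only [Copy.toSubgraph, Subgraph.map_adj, Relation.Map] at h1
    obtain ⟨a, b, hab, ha, hb⟩ := h1
    exact ⟨a, b, hab, ha, hb⟩
  have step : ∀ i j a, (cycleGraph 6).Adj i j → φ a = ψ i →
      ∃ b, (cycleGraph 6).Adj a b ∧ φ b = ψ j := by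
    intro i j a hij ha
    obtain ⟨a', b, hab, ha', hb⟩ := hadj i j hij
    obtain rfl : a' = a := φ.injective (ha'.trans ha.symm)
    exact ⟨b, hab, hb⟩
  obtain ⟨a, ha, ha'⟩ := step 0 1 0 (by decide) h0
  obtain ⟨b, hb, hb'⟩ := step 1 2 a (by decide) ha'
  obtain ⟨c, hc, hc'⟩ := step 2 3 b (by decide) hb'
  obtain ⟨d, hd, hd'⟩ := step 3 4 c (by decide) hc'
  obtain ⟨e, he, he'⟩ := step 4 5 d (by decide) hd'
  have hne : ∀ {i j x y}, φ x = ψ i → φ y = ψ j → i ≠ j → x ≠ y := by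
    rintro i j x y hx hy hij rfl
    exact hij (ψ.injective (hx.symm.trans hy))
  have turn : ∀ x y z : Fin 6, (cycleGraph 6).Adj x y → (cycleGraph 6).Adj y z → z ≠ x →
      z = y + (y - x) := by
    decide
  have hstart : ∀ a : Fin 6, (cycleGraph 6).Adj 0 a → a = 1 ∨ a = -1 := by decide
  obtain rfl := turn _ _ _ ha hb (hne hb' h0 (by decide))
  obtain rfl := turn _ _ _ hb hc (hne hc' ha' (by decide))
  obtain rfl := turn _ _ _ hc hd (hne hd' hb' (by decide))
  obtain rfl := turn _ _ _ hd he (hne he' hc' (by decide))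
  obtain rfl | rfl := hstart a ha
  · left
    funext i
    fin_cases i
    exacts [h0.symm, ha'.symm, hb'.symm, hc'.symm, hd'.symm, he'.symm]
  · right
    funext i
    fin_cases i
    exacts [h0.symm, ha'.symm, hb'.symm, hc'.symm, hd'.symm, he'.symm]

/-- Every hexagon through `v` is the image of at most two copies based at `v`. -/
theorem card_copy_based_le_two_mul_hexCountAt {V : Type*} [Finite V] (G : SimpleGraph V) (v : V) :
    Nat.card {φ : Copy (cycleGraph 6) G // φ 0 = v} ≤ 2 * hexCountAt G v := by
  classical
  have : Finite (Copy (cycleGraph 6) G) := DFunLike.finite _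
  have : Fintype {φ : Copy (cycleGraph 6) G // φ 0 = v} := Fintype.ofFinite _
  set T : Set G.Subgraph :=
    {H | v ∈ H.verts ∧ Nonempty (H.coe ≃g cycleGraph 6)}
  have hfin : T.Finite := Set.toFinite _
  have hcount : hexCountAt G v = hfin.toFinset.card := Set.ncard_eq_toFinset_card _ hfin
  rw [Nat.card_eq_fintype_card, hcount]
  refine Finset.card_le_mul_card_image_of_maps_to (s := Finset.univ) (t := hfin.toFinset)
    (f := fun φ : {φ : Copy (cycleGraph 6) G // φ 0 = v} => φ.1.toSubgraph) ?_ 2 ?_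
  · rintro ⟨φ, hφ⟩ -
    rw [Set.Finite.mem_toFinset]
    refine ⟨?_, ⟨φ.isoToSubgraph.symm⟩⟩
    exact ⟨0, trivial, hφ⟩
  · intro H _
    by_contra! hcard
    obtain ⟨x, y, z, hx, hy, hz, hxy, hxz, hyz⟩ := Finset.two_lt_card_iff.1 hcard
    simp only [Finset.mem_filter, Finset.mem_univ, true_and] at hx hy hz
    have hinj : ∀ {p q : {φ : Copy (cycleGraph 6) G // φ 0 = v}}, ⇑p.1 = ⇑q.1 → p = q :=
      fun h => Subtype.ext (DFunLike.coe_injective h)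
    rcases copy_eq_or_eq_neg_of_toSubgraph_eq (x.2.trans y.2.symm) (hx.trans hy.symm) with h | h
    · exact hxy (hinj h.symm)
    rcases copy_eq_or_eq_neg_of_toSubgraph_eq (x.2.trans z.2.symm) (hx.trans hz.symm) with h' | h'
    · exact hxz (hinj h'.symm)
    exact hyz (hinj (h.trans h'.symm))

/-- Two sets with at least `δ / 2 ≥ 2` elements span at least `δ² / 8` pairs of distinct elements. -/
theorem sq_div_eight_le_card_distinct_pairs {V : Type*} [Finite V] (A B : Set V) {δ : ℝ}
    (hδ : 4 ≤ δ) (hA : δ / 2 ≤ (A.ncard : ℝ)) (hB : δ / 2 ≤ (B.ncard : ℝ)) :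
    δ ^ 2 / 8 ≤ (Nat.card {q : V × V // q.1 ∈ A ∧ q.2 ∈ B ∧ q.1 ≠ q.2} : ℝ) := by
  classical
  have hsig : Nat.card (Σ a : A, ↥(B \ {a.1})) ≤
      Nat.card {q : V × V // q.1 ∈ A ∧ q.2 ∈ B ∧ q.1 ≠ q.2} := by
    refine Nat.card_le_card_of_injective
      (fun t => ⟨(t.1.1, t.2.1), t.1.2, t.2.2.1, fun h => t.2.2.2 h.symm⟩) ?_
    rintro ⟨⟨a, ha⟩, b, hb⟩ ⟨⟨a', ha'⟩, b', hb'⟩ h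
    simp only [Subtype.mk.injEq, Prod.mk.injEq] at h
    obtain ⟨rfl, rfl⟩ := h
    rfl
  have : Fintype A := Fintype.ofFinite _
  rw [Nat.card_sigma] at hsig
  have hle : A.ncard * (B.ncard - 1) ≤ ∑ a : A, Nat.card ↥(B \ {a.1}) := by
    have hc : A.ncard = (Finset.univ : Finset A).card := by
      rw [Finset.card_univ, ← Nat.card_eq_fintype_card, Nat.card_coe_set_eq]
    rw [hc, ← smul_eq_mul]
    refine Finset.card_nsmul_le_sum _ _ _ fun a _ => ?_
    rw [Nat.card_coe_set_eq]
    exact Set.pred_ncard_le_ncard_sdiff_singleton B a.1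
  have hB1 : 1 ≤ B.ncard := by
    have : (1 : ℝ) ≤ (B.ncard : ℝ) := by linarith
    exact_mod_cast this
  have hreal : (A.ncard : ℝ) * ((B.ncard : ℝ) - 1) ≤
      (Nat.card {q : V × V // q.1 ∈ A ∧ q.2 ∈ B ∧ q.1 ≠ q.2} : ℝ) := by
    have := hle.trans hsig
    rw [← Nat.cast_one, ← Nat.cast_sub hB1]
    exact_mod_cast this
  nlinarith [mul_le_mul hA (show δ / 4 ≤ (B.ncard : ℝ) - 1 by linarith) (by linarith) (by linarith)]

/-- The copy of the hexagon traced out by a closed walk through six distinct vertices. -/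
def hexagonCopy {V : Type*} {G : SimpleGraph V} (f : Fin 6 → V) (hf : Function.Injective f)
    (hadj : ∀ i, G.Adj (f i) (f (i + 1))) : Copy (cycleGraph 6) G where
  toHom :=
    { toFun := f
      map_rel' := by
        intro a b hab
        have key : ∀ a b : Fin 6, (cycleGraph 6).Adj a b → b = a + 1 ∨ a = b + 1 := by decide
        rcases key a b hab with rfl | rfl
        exacts [hadj a, (hadj b).symm] }
  injective' := hf

/-- Counting hexagons through `v` from `2`-paths `X — Z — X` together with the
`≥ δ/2`-regularity of `X` into `S ⊆ N(v)` (used when `δ ≥ 4`). -/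
theorem hexagons_from_two_paths
    {V : Type} [Fintype V] (G : SimpleGraph V) (v : V) (S X Z : Set V)
    (hS : S ⊆ G.neighborSet v)
    (hSX : Disjoint S X) (hSZ : Disjoint S Z) (hXZ : Disjoint X Z)
    (hvS : v ∉ S) (hvX : v ∉ X) (hvZ : v ∉ Z)
    (δ : ℝ) (hδ : 4 ≤ δ)
    (hreg : ∀ w ∈ X, δ / 2 ≤ ((G.neighborSet w ∩ S).ncard : ℝ))
    (P : ℕ)
    (hP : P = {p : V × V × V | p.1 ∈ X ∧ p.2.2 ∈ X ∧ p.1 ≠ p.2.2 ∧ p.2.1 ∈ Z ∧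
      G.Adj p.2.1 p.1 ∧ G.Adj p.2.1 p.2.2}.ncard) :
    (hexCountAt G v : ℝ) ≥ δ ^ 2 * (P : ℝ) / 16 := by
  classical
  set T : Set (V × V × V) := {p | p.1 ∈ X ∧ p.2.2 ∈ X ∧ p.1 ≠ p.2.2 ∧ p.2.1 ∈ Z ∧
      G.Adj p.2.1 p.1 ∧ G.Adj p.2.1 p.2.2}
  let Q : T → Type := fun p => {q : V × V //
    q.1 ∈ G.neighborSet p.1.1 ∩ S ∧ q.2 ∈ G.neighborSet p.1.2.2 ∩ S ∧ q.1 ≠ q.2}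
  have : Fintype T := Fintype.ofFinite _
  have : Finite (Copy (cycleGraph 6) G) := DFunLike.finite _
  have hQ : ∀ p : T, δ ^ 2 / 8 ≤ (Nat.card (Q p) : ℝ) := fun p =>
    sq_div_eight_le_card_distinct_pairs _ _ hδ (hreg _ p.2.1) (hreg _ p.2.2.1)
  have hcopy : ∀ t : Σ p : T, Q p, ∃ φ : {φ : Copy (cycleGraph 6) G // φ 0 = v},
      ⇑φ.1 = ![v, t.2.1.1, t.1.1.1, t.1.1.2.1, t.1.1.2.2, t.2.1.2] := by
    rintro ⟨⟨⟨w₁, z, w₂⟩, hw₁, hw₂, hw, hz, hz₁, hz₂⟩, ⟨s₁, s₂⟩, ⟨hs₁, hs₁S⟩, ⟨hs₂, hs₂S⟩, hs⟩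
    dsimp only at *
    have hSX' : ∀ {s w}, s ∈ S → w ∈ X → s ≠ w := fun h h' => hSX.ne_of_mem h h'
    have hSZ' : ∀ {s w}, s ∈ S → w ∈ Z → s ≠ w := fun h h' => hSZ.ne_of_mem h h'
    have hXZ' : ∀ {s w}, s ∈ X → w ∈ Z → s ≠ w := fun h h' => hXZ.ne_of_mem h h'
    have hinj : Function.Injective ![v, s₁, w₁, z, w₂, s₂] := by
      have h1 := hSX' hs₁S hw₁
      have h2 := hSX' hs₁S hw₂
      have h3 := hSX' hs₂S hw₁
      have h4 := hSX' hs₂S hw₂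
      have h5 := hSZ' hs₁S hz
      have h6 := hSZ' hs₂S hz
      have h7 := hXZ' hw₁ hz
      have h8 := hXZ' hw₂ hz
      have g1 : v ≠ s₁ := fun h => hvS (h ▸ hs₁S)
      have g2 : v ≠ s₂ := fun h => hvS (h ▸ hs₂S)
      have g3 : v ≠ w₁ := fun h => hvX (h ▸ hw₁)
      have g4 : v ≠ w₂ := fun h => hvX (h ▸ hw₂)
      have g5 : v ≠ z := fun h => hvZ (h ▸ hz)
      rw [← List.nodup_ofFn]
      simp [List.ofFn_succ, *, h3.symm, h4.symm, h6.symm, h8.symm]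
    refine ⟨⟨hexagonCopy _ hinj ?_, rfl⟩, rfl⟩
    intro i
    fin_cases i
    exacts [hS hs₁S, SimpleGraph.Adj.symm hs₁, hz₁.symm, hz₂, hs₂, SimpleGraph.Adj.symm (hS hs₂S)]
  choose F hF using hcopy
  have hFinj : Function.Injective F := by
    rintro ⟨⟨⟨w₁, z, w₂⟩, hp⟩, ⟨s₁, s₂⟩, hq⟩ ⟨⟨⟨w₁', z', w₂'⟩, hp'⟩, ⟨s₁', s₂'⟩, hq'⟩ h
    have h' := (hF _).symm.trans ((congrArg (fun φ : {φ : Copy (cycleGraph 6) G // φ 0 = v} => ⇑φ.1) h).trans (hF _))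
    obtain rfl : s₁ = s₁' := congrFun h' 1
    obtain rfl : w₁ = w₁' := congrFun h' 2
    obtain rfl : z = z' := congrFun h' 3
    obtain rfl : w₂ = w₂' := congrFun h' 4
    obtain rfl : s₂ = s₂' := congrFun h' 5
    rfl
  have hQfin : ∀ p, Finite (Q p) := fun p => Subtype.finite
  have hle := (Nat.card_le_card_of_injective F hFinj).trans
    (card_copy_based_le_two_mul_hexCountAt G v)
  rw [Nat.card_sigma] at hle
  have hle' : ∑ p, (Nat.card (Q p) : ℝ) ≤ 2 * (hexCountAt G v : ℝ) := by exact_mod_cast hle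
  have hsum := Finset.card_nsmul_le_sum Finset.univ (fun p => (Nat.card (Q p) : ℝ)) _
    fun p _ => hQ p
  have hcard : (Finset.univ : Finset T).card = P := by
    rw [hP, Finset.card_univ, ← Nat.card_eq_fintype_card, Nat.card_coe_set_eq]
  rw [hcard, nsmul_eq_mul] at hsum
  linarith
end
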